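/- Consider the Kripke frame (ω+1, >). For any valuation v : Prop → P(ω+1) and n ∈ ω, define vₙ by vₙ(p) = v(p) ∪ {n} if ω ∈ v(p) and vₙ(p) = v(p) \ {n} otherwise. Then for every modal formula ψ and every valuation v, there exists N ∈ ω such that for every n ≥ N and every subformula α of ψ: ω belongs to the truth set of α in (ω+1, >, v) if and only if n belongs to the truth set of α in (ω+1, >, vₙ). -/

import Mathlib

/-- Modal formulas over a countable set of propositional variables. -/
inductive Fml : Type where
  | prop : ℕ → Fml
  | top : Fml
  | and : Fml → Fml → Fml
  | neg : Fml → Fml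
  | box : Fml → Fml

namespace Fml
/-- `⊥` abbreviates `¬⊤`. -/
def bot : Fml := neg top
/-- `φ ∨ ψ` abbreviates `¬(¬φ ∧ ¬ψ)`. -/
def or (φ ψ : Fml) : Fml := neg (and (neg φ) (neg ψ))
/-- `φ ⊃ ψ` abbreviates `¬(φ ∧ ¬ψ)`. -/
def imp (φ ψ : Fml) : Fml := neg (and φ (neg ψ))
/-- `◇φ` abbreviates `¬□¬φ`. -/
def dia (φ : Fml) : Fml := neg (box (neg φ))
/-- `◇ⁿφ`: n-fold application of `◇`. -/
def dian : ℕ → Fml → Fml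
  | 0, φ => φ
  | n+1, φ => dia (dian n φ)
end Fml

/-- Truth of a modal formula at a world of a Kripke model `(W, R, v)`. -/
def Truth {W : Type} (R : W → W → Prop) (v : ℕ → Set W) : Fml → W → Prop
  | .prop n, w => w ∈ v n
  | .top, _ => True
  | .and φ ψ, w => Truth R v φ w ∧ Truth R v ψ w
  | .neg φ, w => ¬ Truth R v φ w
  | .box φ, w => ∀ w', R w w' → Truth R v φ w'

/-- The accessibility relation of the frame `(ω+1, >)`. -/
def Rgt (w w' : ℕ∞) : Prop := w' < w

open Classical

/-- The modified valuation `vₙ`. -/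
def vshift (v : ℕ → Set ℕ∞) (n : ℕ) (p : ℕ) : Set ℕ∞ :=
  if (⊤ : ℕ∞) ∈ v p then v p ∪ {(n : ℕ∞)} else v p \ {(n : ℕ∞)}

/-- `Subf α φ` : `α` is a subformula of `φ`. -/
inductive Subf : Fml → Fml → Prop where
  | refl (φ) : Subf φ φ
  | and_left {α φ ψ} : Subf α φ → Subf α (Fml.and φ ψ)
  | and_right {α φ ψ} : Subf α ψ → Subf α (Fml.and φ ψ)
  | neg {α φ} : Subf α φ → Subf α (Fml.neg φ)
  | box {α φ} : Subf α φ → Subf α (Fml.box φ)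

theorem vshift_mem_of_lt (v : ℕ → Set ℕ∞) (n p : ℕ) (w : ℕ∞) (hw : w < n) :
    w ∈ vshift v n p ↔ w ∈ v p := by
  unfold vshift
  split_ifs <;> simp [hw.ne]

theorem vshift_mem_self (v : ℕ → Set ℕ∞) (n p : ℕ) :
    (n : ℕ∞) ∈ vshift v n p ↔ (⊤ : ℕ∞) ∈ v p := by
  unfold vshift
  split_ifs with h <;> simp [h]

theorem truth_vshift_of_lt (v : ℕ → Set ℕ∞) (n : ℕ) (α : Fml) :
    ∀ w : ℕ∞, w < n → (Truth Rgt (vshift v n) α w ↔ Truth Rgt v α w) := by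
  induction α with
  | prop p => exact fun w hw => vshift_mem_of_lt v n p w hw
  | top => exact fun w hw => Iff.rfl
  | and φ ψ h1 h2 => exact fun w hw => and_congr (h1 w hw) (h2 w hw)
  | neg φ h => exact fun w hw => not_congr (h w hw)
  | box φ ih =>
    intro w hw
    constructor
    · intro H x hx
      exact (ih x (lt_trans hx hw)).1 (H x hx)
    · intro H x hx
      exact (ih x (lt_trans hx hw)).2 (H x hx)

theorem stmt13 (ψ : Fml) (v : ℕ → Set ℕ∞) :
    ∃ N : ℕ, ∀ n : ℕ, N ≤ n → ∀ α : Fml, Subf α ψ →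
      (Truth Rgt v α (⊤ : ℕ∞) ↔ Truth Rgt (vshift v n) α (n : ℕ∞)) := by
  induction ψ with
  | prop p =>
    refine ⟨0, fun n _ α hα => ?_⟩
    cases hα
    exact (vshift_mem_self v n p).symm
  | top =>
    refine ⟨0, fun n _ α hα => ?_⟩
    cases hα
    exact Iff.rfl
  | and φ χ h1 h2 =>
    obtain ⟨N1, h1⟩ := h1
    obtain ⟨N2, h2⟩ := h2
    refine ⟨max N1 N2, fun n hn α hα => ?_⟩
    have a1 := h1 n (le_trans (le_max_left _ _) hn)
    have a2 := h2 n (le_trans (le_max_right _ _) hn)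
    cases hα with
    | refl => exact and_congr (a1 _ (.refl _)) (a2 _ (.refl _))
    | and_left h => exact a1 _ h
    | and_right h => exact a2 _ h
  | neg φ h1 =>
    obtain ⟨N1, h1⟩ := h1
    refine ⟨N1, fun n hn α hα => ?_⟩
    cases hα with
    | refl => exact not_congr (h1 n hn _ (.refl _))
    | neg h => exact h1 n hn _ h
  | box φ h1 =>
    obtain ⟨N1, h1⟩ := h1
    by_cases hb : Truth Rgt v (Fml.box φ) ⊤
    · refine ⟨N1, fun n hn α hα => ?_⟩
      cases hα with
      | refl =>
        refine iff_of_true hb fun w hw => ?_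
        exact (truth_vshift_of_lt v n φ w hw).2 (hb w (lt_of_lt_of_le hw le_top))
      | box h => exact h1 n hn _ h
    · have hb' : ∃ w : ℕ∞, w < ⊤ ∧ ¬ Truth Rgt v φ w := by
        by_contra hc
        push Not at hc
        exact hb hc
      obtain ⟨w, hw, hf⟩ := hb'
      lift w to ℕ using hw.ne
      refine ⟨max N1 (w + 1), fun n hn α hα => ?_⟩
      have hwn : (w : ℕ∞) < n := by
        have : w < n := le_trans (le_max_right N1 (w + 1)) hn
        exact_mod_cast this
      cases hα with
      | refl =>
        refine iff_of_false hb fun hc => hf ?_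
        exact (truth_vshift_of_lt v n φ w hwn).1 (hc w hwn)
      | box h => exact h1 n (le_trans (le_max_left _ _) hn) _ h
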